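/- arXiv:2503.06180 — 3 statements merged into one kernel-verified Lean document; each statement's English description precedes it below -/
import Mathlib

section
/- Let 𝓔, ℱ_e, ℱ_o ⊆ 𝒫([n]) and let μ be an integrable measure on ℝⁿ. Then μ is universal on ℳ^int(𝓔; ℱ_e, ℱ_o) if and only if L(μ) is spherically universal on ℳ^sph(𝓔_L; ℱ_e^0, ℱ_o), where 𝓔_L = {{0}∪E : E ∈ 𝓔} and ℱ_e^0 = ℱ_e ∪ {{0}∪[n]}. -/
open MeasureTheory
open scoped ENNReal symmDiff Classical

noncomputable section

/-- The Euclidean (ℓ²) norm on `Fin n → ℝ`. -/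
def e2 {n : ℕ} (x : Fin n → ℝ) : ℝ := Real.sqrt (∑ i, (x i) ^ 2)

/-- The unit sphere `S^{n-1}` in `ℝⁿ`. -/
def Sph (n : ℕ) : Set (Fin n → ℝ) := {x | e2 x = 1}

/-- The set `A_E = {x : xᵢ ≠ 0 ↔ i ∈ E}`. -/
def setA {n : ℕ} (E : Finset (Fin n)) : Set (Fin n → ℝ) := {x | ∀ i, x i ≠ 0 ↔ i ∈ E}

/-- Finite signed Borel measures on `ℝⁿ`. -/
abbrev SM (n : ℕ) := MeasureTheory.SignedMeasure (Fin n → ℝ)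

/-- A (finite) measure regarded as a signed measure (junk value `0` if not finite). -/
def toSigned {X : Type*} [MeasurableSpace X] (ρ : Measure X) : SignedMeasure X :=
  if h : IsFiniteMeasure ρ then @Measure.toSignedMeasure X _ ρ h else 0

/-- Multiplicative convolution of two non-negative measures. -/
def mconvPos {n : ℕ} (ρ σ : Measure (Fin n → ℝ)) : Measure (Fin n → ℝ) :=
  (ρ.prod σ).map (fun p => p.1 * p.2)

/-- Multiplicative convolution `μ ⊛ ν` of two signed measures, via Jordan decomposition. -/
def mconv {n : ℕ} (μ ν : SM n) : SM n :=
  toSigned (mconvPos μ.toJordanDecomposition.posPart ν.toJordanDecomposition.posPart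
      + mconvPos μ.toJordanDecomposition.negPart ν.toJordanDecomposition.negPart)
  - toSigned (mconvPos μ.toJordanDecomposition.posPart ν.toJordanDecomposition.negPart
      + mconvPos μ.toJordanDecomposition.negPart ν.toJordanDecomposition.posPart)

/-- `μ` is integrable: `∫ ‖x‖₂ d|μ| < ∞`. -/
def IntegrableSM {n : ℕ} (μ : SM n) : Prop :=
  ∫⁻ x, ENNReal.ofReal (e2 x) ∂μ.totalVariation < ⊤

/-- `μ` is concentrated on `A`:  `|μ|(Aᶜ) = 0`. -/
def ConcOn {n : ℕ} (μ : SM n) (A : Set (Fin n → ℝ)) : Prop := μ.totalVariation Aᶜ = 0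

/-- The multiple reflection `T_E` on `ℝⁿ`. -/
def flipE {n : ℕ} (E : Finset (Fin n)) (x : Fin n → ℝ) : Fin n → ℝ :=
  fun i => if i ∈ E then -x i else x i

/-- Pushforward of a signed measure under `T_E`. -/
def Tmap {n : ℕ} (E : Finset (Fin n)) (μ : SM n) : SM n := μ.map (flipE E)

def EvenUnder {n : ℕ} (μ : SM n) (E : Finset (Fin n)) : Prop := Tmap E μ = μ
def OddUnder {n : ℕ} (μ : SM n) (E : Finset (Fin n)) : Prop := Tmap E μ = -μ

/-- Orthogonal projection onto the coordinate subspace `H_E`. -/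
def projE {n : ℕ} (E : Finset (Fin n)) (x : Fin n → ℝ) : Fin n → ℝ :=
  fun i => if i ∈ E then x i else 0

/-- `P_E(μ)`: pushforward under `projE`. -/
def Pmap {n : ℕ} (E : Finset (Fin n)) (μ : SM n) : SM n := μ.map (projE E)

/-- `R_E(μ) = μ_E`: restriction to `A_E`. -/
def Rres {n : ℕ} (E : Finset (Fin n)) (μ : SM n) : SM n := μ.restrict (setA E)

/-- Sign vector attached to `b : Fin n → Bool`. -/
def signVec {n : ℕ} (b : Fin n → Bool) : Fin n → ℝ := fun i => if b i then 1 else -1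

/-- The measure `δ_J = 2^{-n} ∑_{s ∈ 𝒮ⁿ} σ_J(s) δ_s`. -/
def deltaJ {n : ℕ} (J : Finset (Fin n)) : SM n :=
  ((2 : ℝ) ^ n)⁻¹ •
    ∑ b : Fin n → Bool,
      (∏ j ∈ J, (if b j then (1 : ℝ) else -1)) • toSigned (Measure.dirac (signVec b))

/-- `𝒥(E; Fe, Fo)`. -/
def JsetE {n : ℕ} (E : Finset (Fin n)) (Fe Fo : Set (Finset (Fin n))) :
    Set (Finset (Fin n)) :=
  {J | J ⊆ E ∧ (∀ F ∈ Fe, Even (J ∩ F).card) ∧ (∀ F ∈ Fo, Odd (J ∩ F).card)}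

/-- `𝒥(Fe, Fo) = 𝒥([n]; Fe, Fo)`. -/
def Jset {n : ℕ} (Fe Fo : Set (Finset (Fin n))) : Set (Finset (Fin n)) :=
  {J | (∀ F ∈ Fe, Even (J ∩ F).card) ∧ (∀ F ∈ Fo, Odd (J ∩ F).card)}

/-- `G` has a representation `G = F₁ Δ … Δ F_m` with each `Fᵢ` drawn from `Fe` or `Fo`,
in which the number of terms drawn from `Fo` is even (`odd = false`) or odd (`odd = true`). -/
def HasRep {n : ℕ} (Fe Fo : Set (Finset (Fin n))) (G : Finset (Fin n)) (odd : Bool) : Prop :=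
  ∃ l : List (Finset (Fin n) × Bool),
    (∀ p ∈ l, if p.2 then p.1 ∈ Fo else p.1 ∈ Fe) ∧
    (l.map Prod.fst).foldr (· ∆ ·) ∅ = G ∧
    (l.countP (fun p => p.2)) % 2 = (if odd then 1 else 0)

/-- The generating pair `(Fe, Fo)` is proper: the even and odd parts of the generated group
are disjoint. -/
def ProperPair {n : ℕ} (Fe Fo : Set (Finset (Fin n))) : Prop :=
  ∀ G : Finset (Fin n), ¬ (HasRep Fe Fo G false ∧ HasRep Fe Fo G true)

/-- `ℳ^int(A; Fe, Fo)`: integrable signed measures concentrated on `A`, even under `T_F`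
for `F ∈ Fe` and odd under `T_F` for `F ∈ Fo`. -/
def MclassInt {n : ℕ} (A : Set (Fin n → ℝ)) (Fe Fo : Set (Finset (Fin n))) : Set (SM n) :=
  {μ | IntegrableSM μ ∧ ConcOn μ A ∧ (∀ F ∈ Fe, EvenUnder μ F) ∧ (∀ F ∈ Fo, OddUnder μ F)}

/-- `ν` is universal on `𝒜`. -/
def Universal {n : ℕ} (ν : SM n) (𝒜 : Set (SM n)) : Prop :=
  ∀ μ ∈ 𝒜, mconv ν μ = 0 → μ = 0

/-- Radial projection of a non-negative measure. -/
def radPos {n : ℕ} (ρ : Measure (Fin n → ℝ)) : Measure (Fin n → ℝ) :=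
  (ρ.withDensity fun x => ENNReal.ofReal (e2 x)).map (fun x => (e2 x)⁻¹ • x)

/-- Radial projection `P_S` of a signed measure. -/
def PS {n : ℕ} (μ : SM n) : SM n :=
  toSigned (radPos μ.toJordanDecomposition.posPart) -
    toSigned (radPos μ.toJordanDecomposition.negPart)

/-- The spherical product `μ ⊛_S ν = P_S(μ ⊛ ν)`. -/
def mconvS {n : ℕ} (μ ν : SM n) : SM n := PS (mconv μ ν)

/-- `ν` is spherically universal on `𝒜`. -/
def SphUniversal {n : ℕ} (ν : SM n) (𝒜 : Set (SM n)) : Prop :=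
  ∀ μ ∈ 𝒜, mconvS ν μ = 0 → μ = 0

/-- The unconditional symmetrisation `M_unc`. -/
def Munc {n : ℕ} (μ : SM n) : SM n := ((2 : ℝ) ^ n)⁻¹ • ∑ E : Finset (Fin n), Tmap E μ

/-- Integral of `f` against a signed measure. -/
def sInt {n : ℕ} (μ : SM n) (f : (Fin n → ℝ) → ℝ) : ℝ :=
  (∫ x, f x ∂μ.toJordanDecomposition.posPart) - ∫ x, f x ∂μ.toJordanDecomposition.negPart

/-- `δ₁ ⊗ μ`: the lifting of `μ` to a measure on `ℝ^{n+1}`, with an extra `0`-th coordinate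
carrying a unit atom at `1`. -/
def lift0 {n : ℕ} (μ : SM n) : SM (n + 1) := μ.map (fun x => Fin.cons 1 x)

/-- Symmetrisation about the origin. -/
def Msym {n : ℕ} (μ : SM n) : SM n := (2 : ℝ)⁻¹ • (μ + μ.map (fun x => -x))

/-- The lifting `L(μ) = P_S(M_sym(δ₁ ⊗ μ))`. -/
def Lift {n : ℕ} (μ : SM n) : SM (n + 1) := PS (Msym (lift0 μ))


section Representation

variable {X : Type*} [MeasurableSpace X]

/-- The signed measure `μ` is the difference of the finite measures `p` and `q`. -/
def DiffOf (μ : SignedMeasure X) (p q : Measure X) : Prop :=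
  IsFiniteMeasure p ∧ IsFiniteMeasure q ∧
    ∀ A, MeasurableSet A → μ A = p.real A - q.real A

lemma toSigned_apply {p : Measure X} (hp : IsFiniteMeasure p) {A : Set X}
    (hA : MeasurableSet A) : toSigned p A = p.real A := by
  rw [toSigned, dif_pos hp]
  exact Measure.toSignedMeasure_apply_measurable hA

lemma measure_ext_real {p q : Measure X} [IsFiniteMeasure p] [IsFiniteMeasure q]
    (h : ∀ A, MeasurableSet A → p.real A = q.real A) : p = q := by
  ext A hA
  exact (ENNReal.toReal_eq_toReal_iff' (measure_ne_top _ _) (measure_ne_top _ _)).1 (h A hA)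

lemma DiffOf.of_toSigned {p q : Measure X} (hp : IsFiniteMeasure p) (hq : IsFiniteMeasure q) :
    DiffOf (toSigned p - toSigned q) p q := by
  refine ⟨hp, hq, fun A hA => ?_⟩
  rw [sub_apply, toSigned_apply hp hA, toSigned_apply hq hA]

lemma DiffOf.jordan (μ : SignedMeasure X) :
    DiffOf μ μ.toJordanDecomposition.posPart μ.toJordanDecomposition.negPart := by
  refine ⟨inferInstance, inferInstance, fun A hA => ?_⟩
  conv_lhs => rw [← μ.toSignedMeasure_toJordanDecomposition]
  rw [JordanDecomposition.toSignedMeasure, Measure.toSignedMeasure_sub_apply hA]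

lemma DiffOf.balance {μ : SignedMeasure X} {p q p' q' : Measure X} (h : DiffOf μ p q)
    (h' : DiffOf μ p' q') : p + q' = p' + q := by
  obtain ⟨_, _, e⟩ := h
  obtain ⟨_, _, e'⟩ := h'
  refine measure_ext_real fun A hA => ?_
  rw [measureReal_add_apply, measureReal_add_apply]
  linarith [e A hA, e' A hA]

lemma DiffOf.congr {μ : SignedMeasure X} {p q p' q' : Measure X} (h : DiffOf μ p q)
    (hp : IsFiniteMeasure p') (hq : IsFiniteMeasure q') (hb : p + q' = p' + q) :
    DiffOf μ p' q' := by
  obtain ⟨_, _, e⟩ := h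
  refine ⟨hp, hq, fun A hA => ?_⟩
  have : (p + q').real A = (p' + q).real A := by rw [hb]
  rw [measureReal_add_apply, measureReal_add_apply] at this
  linarith [e A hA]

lemma DiffOf.unique {μ ν : SignedMeasure X} {p q : Measure X} (h : DiffOf μ p q) (h' : DiffOf ν p q) :
    μ = ν := by
  ext A hA
  rw [h.2.2 A hA, h'.2.2 A hA]

lemma DiffOf.eq_zero_iff {μ : SignedMeasure X} {p q : Measure X} (h : DiffOf μ p q) :
    μ = 0 ↔ p = q := by
  constructor
  · rintro rfl
    have h0 : DiffOf (0 : SignedMeasure X) 0 0 :=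
      ⟨inferInstance, inferInstance, fun A _ => by simp⟩
    simpa using h.balance h0
  · rintro rfl
    ext A hA
    rw [h.2.2 A hA, sub_self]
    rfl

lemma DiffOf.neg {μ : SignedMeasure X} {p q : Measure X} (h : DiffOf μ p q) : DiffOf (-μ) q p := by
  refine ⟨h.2.1, h.1, fun A hA => ?_⟩
  rw [neg_apply, h.2.2 A hA, neg_sub]

lemma DiffOf.add {μ ν : SignedMeasure X} {p q r s : Measure X} (h : DiffOf μ p q) (h' : DiffOf ν r s) :
    DiffOf (μ + ν) (p + r) (q + s) := by
  obtain ⟨_, _, e⟩ := h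
  obtain ⟨_, _, e'⟩ := h'
  refine ⟨inferInstance, inferInstance, fun A hA => ?_⟩
  rw [add_apply, e A hA, e' A hA, measureReal_add_apply, measureReal_add_apply]
  ring

lemma DiffOf.half {μ : SignedMeasure X} {p q : Measure X} (h : DiffOf μ p q) :
    DiffOf ((2 : ℝ)⁻¹ • μ) ((2 : ℝ≥0∞)⁻¹ • p) ((2 : ℝ≥0∞)⁻¹ • q) := by
  obtain ⟨_, _, e⟩ := h
  refine ⟨Measure.smul_finite _ (by simp), Measure.smul_finite _ (by simp), fun A hA => ?_⟩
  rw [smul_apply, e A hA, measureReal_ennreal_smul_apply,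
    measureReal_ennreal_smul_apply]
  simp [mul_sub]

lemma DiffOf.map {Y : Type*} [MeasurableSpace Y] {μ : SignedMeasure X} {p q : Measure X}
    (h : DiffOf μ p q) {f : X → Y} (hf : Measurable f) :
    DiffOf (μ.map f) (p.map f) (q.map f) := by
  obtain ⟨_, _, e⟩ := h
  refine ⟨inferInstance, inferInstance, fun A hA => ?_⟩
  rw [VectorMeasure.map_apply _ hf hA, e _ (hf hA), map_measureReal_apply hf hA,
    map_measureReal_apply hf hA]

lemma DiffOf.posPart_le {μ : SignedMeasure X} {p q : Measure X} (h : DiffOf μ p q) :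
    μ.toJordanDecomposition.posPart ≤ p := by
  obtain ⟨i, hi, hi₂, hi₃, hpos, -⟩ := μ.toJordanDecomposition_spec
  obtain ⟨_, _, e⟩ := h
  refine Measure.le_iff.2 fun A hA => ?_
  rw [← ENNReal.toReal_le_toReal (measure_ne_top _ _) (measure_ne_top _ _)]
  change Measure.real _ A ≤ p.real A
  rw [hpos, SignedMeasure.toMeasureOfZeroLE_real_apply _ hi₂ hi hA, e _ (hi.inter hA)]
  have h1 : p.real (i ∩ A) ≤ p.real A := measureReal_mono Set.inter_subset_right
  have h2 : 0 ≤ q.real (i ∩ A) := measureReal_nonneg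
  linarith

lemma DiffOf.negPart_le {μ : SignedMeasure X} {p q : Measure X} (h : DiffOf μ p q) :
    μ.toJordanDecomposition.negPart ≤ q := by
  have := h.neg.posPart_le
  rwa [SignedMeasure.toJordanDecomposition_neg, JordanDecomposition.neg_posPart] at this

/-- Signed measures represented by additive images of the parts of a signed measure. -/
lemma DiffOf.congr_additive {Y : Type*} [MeasurableSpace Y] {μ : SignedMeasure X}
    {ν : SignedMeasure Y} {p q p' q' : Measure X} (Φ : Measure X → Measure Y)
    (hΦ : ∀ r s, Φ (r + s) = Φ r + Φ s) (h : DiffOf μ p q) (h' : DiffOf μ p' q')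
    (hν : DiffOf ν (Φ p) (Φ q)) (hp : IsFiniteMeasure (Φ p')) (hq : IsFiniteMeasure (Φ q')) :
    DiffOf ν (Φ p') (Φ q') :=
  hν.congr hp hq (by rw [← hΦ, ← hΦ, h.balance h'])

end Representation

section EuclideanNorm

variable {n : ℕ}

lemma e2_nonneg (x : Fin n → ℝ) : 0 ≤ e2 x := Real.sqrt_nonneg _

lemma e2_smul (c : ℝ) (x : Fin n → ℝ) : e2 (c • x) = |c| * e2 x := by
  simp only [e2, Pi.smul_apply, smul_eq_mul, mul_pow, ← Finset.mul_sum]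
  rw [Real.sqrt_mul (sq_nonneg c), Real.sqrt_sq_eq_abs]

lemma e2_flipE (F : Finset (Fin n)) (x : Fin n → ℝ) : e2 (flipE F x) = e2 x := by
  unfold e2 flipE
  congr 1
  refine Finset.sum_congr rfl fun i _ => ?_
  split_ifs <;> simp

lemma measurable_e2 : Measurable (e2 : (Fin n → ℝ) → ℝ) := by
  unfold e2
  fun_prop

lemma abs_apply_le_e2 (x : Fin n → ℝ) (i : Fin n) : |x i| ≤ e2 x :=
  Real.abs_le_sqrt (Finset.single_le_sum (f := fun i => x i ^ 2)
    (fun _ _ => sq_nonneg _) (Finset.mem_univ i))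

lemma eq_zero_of_e2_eq_zero {x : Fin n → ℝ} (h : e2 x = 0) : x = 0 := by
  funext i
  have := abs_apply_le_e2 x i
  rw [h] at this
  exact abs_nonpos_iff.1 this

lemma e2_mul_le (x y : Fin n → ℝ) : e2 (x * y) ≤ e2 x * e2 y := by
  unfold e2
  rw [← Real.sqrt_mul (Finset.sum_nonneg fun _ _ => sq_nonneg _), Finset.sum_mul]
  refine Real.sqrt_le_sqrt (Finset.sum_le_sum fun i _ => ?_)
  rw [Pi.mul_apply, mul_pow]
  exact mul_le_mul_of_nonneg_left (Finset.single_le_sum (f := fun i => y i ^ 2)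
    (fun _ _ => sq_nonneg _) (Finset.mem_univ i)) (sq_nonneg _)

lemma e2_cons_one (x : Fin n → ℝ) :
    e2 (Fin.cons 1 x : Fin (n + 1) → ℝ) = Real.sqrt (1 + e2 x ^ 2) := by
  unfold e2
  rw [Real.sq_sqrt (Finset.sum_nonneg fun _ _ => sq_nonneg _), Fin.sum_univ_succ]
  simp

lemma e2_cons_one_le (x : Fin n → ℝ) :
    e2 (Fin.cons 1 x : Fin (n + 1) → ℝ) ≤ 1 + e2 x := by
  rw [e2_cons_one]
  exact Real.sqrt_le_iff.2 ⟨by linarith [e2_nonneg x], by nlinarith [e2_nonneg x]⟩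

lemma e2_cons_one_pos (x : Fin n → ℝ) : 0 < e2 (Fin.cons 1 x : Fin (n + 1) → ℝ) := by
  rw [e2_cons_one]
  positivity

lemma e2_tail_le (x : Fin (n + 1) → ℝ) : e2 (Fin.tail x) ≤ e2 x := by
  unfold e2
  rw [Fin.sum_univ_succ (n := n)]
  refine Real.sqrt_le_sqrt ?_
  have := sq_nonneg (x 0)
  simp only [Fin.tail]
  linarith

lemma measurable_cons_one :
    Measurable (fun x : Fin n → ℝ => (Fin.cons 1 x : Fin (n + 1) → ℝ)) := by
  refine measurable_pi_lambda _ fun i => ?_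
  refine Fin.cases ?_ (fun j => ?_) i
  · simp
  · simpa using (measurable_pi_apply j : Measurable fun x : Fin n → ℝ => x j)

lemma measurable_tail : Measurable (fun x : Fin (n + 1) → ℝ => Fin.tail x) :=
  by
  unfold Fin.tail
  fun_prop

lemma measurable_flipE (F : Finset (Fin n)) : Measurable (flipE F) := by
  refine measurable_pi_lambda _ fun i => ?_
  unfold flipE
  by_cases h : i ∈ F
  · simp only [h, if_true]
    fun_prop
  · simp only [h, if_false]
    fun_prop

lemma flipE_smul (F : Finset (Fin n)) (c : ℝ) (x : Fin n → ℝ) :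
    flipE F (c • x) = c • flipE F x := by
  funext i
  simp only [flipE, Pi.smul_apply, smul_eq_mul]
  split_ifs <;> ring

lemma flipE_univ : (flipE Finset.univ : (Fin n → ℝ) → Fin n → ℝ) = fun x => -x := by
  funext x i
  simp [flipE]

lemma flipE_neg (F : Finset (Fin n)) (x : Fin n → ℝ) : flipE F (-x) = -flipE F x := by
  simpa using flipE_smul F (-1) x

lemma flipE_image_succ_cons (F : Finset (Fin n)) (x : Fin n → ℝ) :
    flipE (F.image Fin.succ) (Fin.cons 1 x : Fin (n + 1) → ℝ) = Fin.cons 1 (flipE F x) := by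
  funext i
  refine Fin.cases ?_ (fun j => ?_) i <;> simp [flipE]

lemma flipE_image_succ_zero (F : Finset (Fin n)) (x : Fin (n + 1) → ℝ) :
    flipE (F.image Fin.succ) x 0 = x 0 := by
  simp [flipE]

lemma tail_flipE_image_succ (F : Finset (Fin n)) (x : Fin (n + 1) → ℝ) :
    Fin.tail (flipE (F.image Fin.succ) x) = flipE F (Fin.tail x) := by
  funext j
  simp [flipE, Fin.tail]

lemma e2_neg (x : Fin n → ℝ) : e2 (-x) = e2 x := by
  simpa using e2_smul (-1) x

lemma cons_one_mul (x y : Fin n → ℝ) :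
    (Fin.cons 1 x * Fin.cons 1 y : Fin (n + 1) → ℝ) = Fin.cons 1 (x * y) := by
  funext i
  refine Fin.cases ?_ (fun j => ?_) i <;> simp

lemma cons_one_inv_smul_tail {x : Fin (n + 1) → ℝ} (h : x 0 ≠ 0) :
    (Fin.cons 1 ((x 0)⁻¹ • Fin.tail x) : Fin (n + 1) → ℝ) = (x 0)⁻¹ • x := by
  funext i
  refine Fin.cases ?_ (fun j => ?_) i
  · simp [h]
  · simp [Fin.tail]

end EuclideanNorm

section PositiveMeasures

variable {n : ℕ}

/-- Positive homogeneity of degree one. -/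
def PosHom (g : (Fin n → ℝ) → ℝ≥0∞) : Prop :=
  ∀ c : ℝ, 0 ≤ c → ∀ x, g (c • x) = ENNReal.ofReal c * g x

/-- The positively homogeneous extension of a function from the sphere. -/
def homExt (f : (Fin n → ℝ) → ℝ≥0∞) (z : Fin n → ℝ) : ℝ≥0∞ :=
  ENNReal.ofReal (e2 z) * f ((e2 z)⁻¹ • z)

lemma measurable_inv_e2_smul : Measurable fun x : Fin n → ℝ => (e2 x)⁻¹ • x :=
  measurable_e2.fun_inv.fun_smul measurable_id'

lemma measurable_homExt {f : (Fin n → ℝ) → ℝ≥0∞} (hf : Measurable f) :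
    Measurable (homExt f) :=
  measurable_e2.ennreal_ofReal.mul (hf.comp measurable_inv_e2_smul)

lemma posHom_homExt (f : (Fin n → ℝ) → ℝ≥0∞) : PosHom (homExt f) := by
  intro c hc x
  unfold homExt
  rw [e2_smul, abs_of_nonneg hc, ENNReal.ofReal_mul hc, mul_assoc]
  rcases hc.eq_or_lt with rfl | hc'
  · simp
  · congr 3
    rw [smul_smul, mul_inv, mul_right_comm, inv_mul_cancel₀ hc'.ne', one_mul]

lemma homExt_of_mem_Sph (f : (Fin n → ℝ) → ℝ≥0∞) {z : Fin n → ℝ} (hz : z ∈ Sph n) :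
    homExt f z = f z := by
  have : e2 z = 1 := hz
  simp [homExt, this]

lemma PosHom.homExt_eq {g : (Fin n → ℝ) → ℝ≥0∞} (hg : PosHom g) (z : Fin n → ℝ) :
    homExt g z = g z := by
  unfold homExt
  rw [← hg _ (e2_nonneg z), smul_smul]
  by_cases h : e2 z = 0
  · rw [h, eq_zero_of_e2_eq_zero h, smul_zero]
  · rw [mul_inv_cancel₀ h, one_smul]

lemma lintegral_radPos (ρ : Measure (Fin n → ℝ)) {f : (Fin n → ℝ) → ℝ≥0∞} (hf : Measurable f) :
    ∫⁻ x, f x ∂radPos ρ = ∫⁻ x, homExt f x ∂ρ := by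
  rw [radPos, lintegral_map hf measurable_inv_e2_smul,
    lintegral_withDensity_eq_lintegral_mul _ measurable_e2.ennreal_ofReal
      (hf.fun_comp measurable_inv_e2_smul)]
  rfl

lemma radPos_add (p q : Measure (Fin n → ℝ)) : radPos (p + q) = radPos p + radPos q := by
  rw [radPos, withDensity_add_measure, Measure.map_add _ _ measurable_inv_e2_smul]
  rfl

lemma radPos_univ (ρ : Measure (Fin n → ℝ)) :
    radPos ρ Set.univ = ∫⁻ x, ENNReal.ofReal (e2 x) ∂ρ := by
  rw [← lintegral_one, lintegral_radPos ρ measurable_const]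
  simp [homExt]

lemma measurable_hadamard : Measurable fun p : (Fin n → ℝ) × (Fin n → ℝ) => p.1 * p.2 :=
  measurable_fst.mul measurable_snd

lemma lintegral_mconvPos (ρ σ : Measure (Fin n → ℝ)) [SFinite σ] {f : (Fin n → ℝ) → ℝ≥0∞}
    (hf : Measurable f) :
    ∫⁻ z, f z ∂mconvPos ρ σ = ∫⁻ x, ∫⁻ y, f (x * y) ∂σ ∂ρ := by
  rw [mconvPos, lintegral_map hf measurable_hadamard,
    lintegral_prod _ (hf.fun_comp measurable_hadamard).aemeasurable]

instance mconvPos_finite (ρ σ : Measure (Fin n → ℝ)) [IsFiniteMeasure ρ] [IsFiniteMeasure σ] :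
    IsFiniteMeasure (mconvPos ρ σ) := by
  unfold mconvPos
  infer_instance

lemma mconvPos_add_left (p q r : Measure (Fin n → ℝ)) [IsFiniteMeasure p] [IsFiniteMeasure q]
    [IsFiniteMeasure r] : mconvPos (p + q) r = mconvPos p r + mconvPos q r := by
  rw [mconvPos, Measure.add_prod, Measure.map_add _ _ measurable_hadamard]
  rfl

lemma mconvPos_add_right (p q r : Measure (Fin n → ℝ)) [IsFiniteMeasure p] [IsFiniteMeasure q]
    [IsFiniteMeasure r] : mconvPos r (p + q) = mconvPos r p + mconvPos r q := by
  rw [mconvPos, Measure.prod_add, Measure.map_add _ _ measurable_hadamard]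
  rfl

lemma measurable_half_add_neg {f : (Fin (n + 1) → ℝ) → ℝ≥0∞} (hf : Measurable f) :
    Measurable fun x : Fin n → ℝ =>
      2⁻¹ * (f (Fin.cons 1 x) + f (-(Fin.cons 1 x : Fin (n + 1) → ℝ))) :=
  ((hf.fun_comp measurable_cons_one).fun_add
    (hf.fun_comp measurable_cons_one.fun_neg)).const_mul _

/-- The symmetrised lifting of a positive measure. -/
def symLiftPos (p : Measure (Fin n → ℝ)) : Measure (Fin (n + 1) → ℝ) :=
  (2 : ℝ≥0∞)⁻¹ • (p.map (fun x => Fin.cons 1 x) +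
    (p.map (fun x => Fin.cons 1 x)).map (fun x => -x))

/-- The lifting of a positive measure. -/
def liftPos (p : Measure (Fin n → ℝ)) : Measure (Fin (n + 1) → ℝ) := radPos (symLiftPos p)

lemma symLiftPos_add (p q : Measure (Fin n → ℝ)) :
    symLiftPos (p + q) = symLiftPos p + symLiftPos q := by
  unfold symLiftPos
  rw [Measure.map_add _ _ measurable_cons_one, Measure.map_add _ _ measurable_neg, ← smul_add]
  congr 1
  abel

lemma liftPos_add (p q : Measure (Fin n → ℝ)) : liftPos (p + q) = liftPos p + liftPos q := by
  rw [liftPos, symLiftPos_add, radPos_add]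
  rfl

lemma lintegral_symLiftPos (p : Measure (Fin n → ℝ)) {f : (Fin (n + 1) → ℝ) → ℝ≥0∞}
    (hf : Measurable f) :
    ∫⁻ z, f z ∂symLiftPos p =
      ∫⁻ x, 2⁻¹ * (f (Fin.cons 1 x) + f (-(Fin.cons 1 x))) ∂p := by
  have h1 : Measurable fun x : Fin n → ℝ => f (Fin.cons 1 x) := hf.fun_comp measurable_cons_one
  have h2 : Measurable fun x : Fin n → ℝ => f (-(Fin.cons 1 x)) :=
    hf.fun_comp measurable_cons_one.fun_neg
  rw [symLiftPos, lintegral_smul_measure, lintegral_add_measure, lintegral_map hf measurable_neg,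
    lintegral_map hf measurable_cons_one,
    lintegral_map (hf.fun_comp measurable_neg) measurable_cons_one,
    lintegral_const_mul _ (h1.fun_add h2), lintegral_add_left h1]
  rfl

lemma lintegral_liftPos (p : Measure (Fin n → ℝ)) {f : (Fin (n + 1) → ℝ) → ℝ≥0∞}
    (hf : Measurable f) :
    ∫⁻ z, f z ∂liftPos p =
      ∫⁻ x, 2⁻¹ * (homExt f (Fin.cons 1 x) + homExt f (-(Fin.cons 1 x))) ∂p := by
  rw [liftPos, lintegral_radPos _ hf, lintegral_symLiftPos _ (measurable_homExt hf)]

lemma lintegral_liftPos_of_posHom (p : Measure (Fin n → ℝ)) {g : (Fin (n + 1) → ℝ) → ℝ≥0∞}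
    (hg : Measurable g) (hh : PosHom g) :
    ∫⁻ z, g z ∂liftPos p = ∫⁻ x, 2⁻¹ * (g (Fin.cons 1 x) + g (-(Fin.cons 1 x))) ∂p := by
  rw [lintegral_liftPos p hg]
  simp only [hh.homExt_eq]

lemma lintegral_e2_symLiftPos (p : Measure (Fin n → ℝ)) :
    ∫⁻ z, ENNReal.ofReal (e2 z) ∂symLiftPos p =
      ∫⁻ x, ENNReal.ofReal (e2 (Fin.cons 1 x : Fin (n + 1) → ℝ)) ∂p := by
  rw [lintegral_symLiftPos _ measurable_e2.ennreal_ofReal]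
  refine lintegral_congr fun x => ?_
  rw [e2_neg, ← two_mul, ← mul_assoc, ENNReal.inv_mul_cancel (by simp) (by simp), one_mul]

lemma lintegral_e2_symLiftPos_lt_top {p : Measure (Fin n → ℝ)} [IsFiniteMeasure p]
    (hp : ∫⁻ x, ENNReal.ofReal (e2 x) ∂p < ⊤) :
    ∫⁻ z, ENNReal.ofReal (e2 z) ∂symLiftPos p < ⊤ := by
  rw [lintegral_e2_symLiftPos]
  calc _ ≤ ∫⁻ x, (1 + ENNReal.ofReal (e2 x)) ∂p := lintegral_mono fun x => by
        rw [← ENNReal.ofReal_one, ← ENNReal.ofReal_add zero_le_one (e2_nonneg x)]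
        exact ENNReal.ofReal_le_ofReal (e2_cons_one_le x)
    _ < ⊤ := by
        rw [lintegral_add_left measurable_const, lintegral_const, one_mul]
        exact ENNReal.add_lt_top.2 ⟨measure_lt_top _ _, hp⟩

/-- The lifting turns multiplicative convolution into the spherical product. -/
lemma radPos_mconvPos_liftPos (p q : Measure (Fin n → ℝ)) [IsFiniteMeasure q]
    [IsFiniteMeasure (liftPos q)] :
    radPos (mconvPos (liftPos p) (liftPos q)) = liftPos (mconvPos p q) := by
  refine Measure.ext_of_lintegral _ fun f hf => ?_
  have hm := measurable_homExt hf
  have hh := posHom_homExt f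
  rw [lintegral_radPos _ hf, lintegral_mconvPos _ _ hm, lintegral_liftPos _ hf,
    lintegral_mconvPos _ _ (measurable_half_add_neg hm)]
  have hmul : Measurable fun z : (Fin (n + 1) → ℝ) × (Fin (n + 1) → ℝ) => homExt f (z.1 * z.2) :=
    hm.fun_comp measurable_hadamard
  rw [lintegral_liftPos_of_posHom _ hmul.lintegral_prod_right' ?_]
  · refine lintegral_congr fun x => ?_
    have h (a : Fin (n + 1) → ℝ) : ∫⁻ y, homExt f (a * y) ∂liftPos q =
        ∫⁻ y, 2⁻¹ * (homExt f (a * Fin.cons 1 y) + homExt f (a * -(Fin.cons 1 y))) ∂q := by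
      rw [lintegral_liftPos_of_posHom _ (hm.fun_comp (measurable_const.fun_mul measurable_id'))]
      intro c hc y
      beta_reduce
      rw [mul_smul_comm, hh c hc]
    rw [h, h]
    have hn : ∀ y : Fin n → ℝ, 2⁻¹ * (homExt f (-Fin.cons 1 x * Fin.cons 1 y) +
        homExt f (-Fin.cons 1 x * -(Fin.cons 1 y))) = 2⁻¹ * (homExt f (Fin.cons 1 x * Fin.cons 1 y) +
        homExt f (Fin.cons 1 x * -(Fin.cons 1 y))) := fun y => by
      rw [neg_mul_neg, neg_mul, mul_neg, add_comm]
    simp only [hn]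
    rw [← two_mul, ← mul_assoc, ENNReal.inv_mul_cancel (by simp) (by simp), one_mul]
    simp only [mul_neg, cons_one_mul]
  · intro c hc x
    rw [← lintegral_const_mul _ (hm.fun_comp (measurable_const.fun_mul measurable_id'))]
    simp only [smul_mul_assoc, hh c hc]

/-- The inverse of the lifting. -/
def unliftPos (r : Measure (Fin (n + 1) → ℝ)) : Measure (Fin n → ℝ) :=
  (r.withDensity fun x => ENNReal.ofReal |x 0|).map fun x => (x 0)⁻¹ • Fin.tail x

lemma measurable_abs_zero : Measurable fun x : Fin (n + 1) → ℝ => ENNReal.ofReal |x 0| :=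
  (measurable_pi_apply 0).abs.ennreal_ofReal

lemma measurable_inv_smul_tail :
    Measurable fun x : Fin (n + 1) → ℝ => (x 0)⁻¹ • Fin.tail x :=
  (measurable_pi_apply 0).inv.smul measurable_tail

lemma unliftPos_add (p q : Measure (Fin (n + 1) → ℝ)) :
    unliftPos (p + q) = unliftPos p + unliftPos q := by
  rw [unliftPos, withDensity_add_measure, Measure.map_add _ _ measurable_inv_smul_tail]
  rfl

lemma lintegral_unliftPos (r : Measure (Fin (n + 1) → ℝ)) {f : (Fin n → ℝ) → ℝ≥0∞}
    (hf : Measurable f) :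
    ∫⁻ x, f x ∂unliftPos r = ∫⁻ y, ENNReal.ofReal |y 0| * f ((y 0)⁻¹ • Fin.tail y) ∂r := by
  rw [unliftPos, lintegral_map hf measurable_inv_smul_tail,
    lintegral_withDensity_eq_lintegral_mul _ measurable_abs_zero
      (hf.fun_comp measurable_inv_smul_tail)]
  rfl

lemma unliftPos_liftPos (p : Measure (Fin n → ℝ)) : unliftPos (liftPos p) = p := by
  refine Measure.ext_of_lintegral _ fun f hf => ?_
  rw [lintegral_unliftPos _ hf, lintegral_liftPos_of_posHom _
    (measurable_abs_zero.fun_mul (hf.fun_comp measurable_inv_smul_tail))]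
  · refine lintegral_congr fun x => ?_
    have ht : Fin.tail (-(Fin.cons 1 x : Fin (n + 1) → ℝ)) = -x := by
      funext i
      simp [Fin.tail]
    simp only [Pi.neg_apply, Fin.cons_zero, Fin.tail_cons, ht]
    simp only [abs_neg, abs_one, ENNReal.ofReal_one, inv_neg, inv_one, one_smul, neg_smul,
      neg_neg, one_mul]
    rw [← two_mul, ← mul_assoc, ENNReal.inv_mul_cancel (by simp) (by simp), one_mul]
  · intro c hc x
    beta_reduce
    rw [Pi.smul_apply, smul_eq_mul, abs_mul, abs_of_nonneg hc, ENNReal.ofReal_mul hc, mul_assoc]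
    rcases hc.eq_or_lt with rfl | hc'
    · simp
    · congr 3
      have : Fin.tail (c • x) = c • Fin.tail x := rfl
      rw [this, smul_smul, mul_inv, mul_right_comm, inv_mul_cancel₀ hc'.ne', one_mul]

lemma liftPos_unliftPos {r : Measure (Fin (n + 1) → ℝ)}
    (hr : ∀ᵐ x ∂r, x 0 ≠ 0 ∧ x ∈ Sph (n + 1)) :
    liftPos (unliftPos r) = (2 : ℝ≥0∞)⁻¹ • (r + r.map fun x => -x) := by
  refine Measure.ext_of_lintegral _ fun f hf => ?_
  have hm := measurable_homExt hf
  rw [lintegral_liftPos _ hf, lintegral_unliftPos _ (measurable_half_add_neg hm), lintegral_smul_measure,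
    lintegral_add_measure, lintegral_map hf measurable_neg, ← lintegral_add_left hf, smul_eq_mul,
    ← lintegral_const_mul _ (hf.fun_add (hf.fun_comp measurable_neg))]
  refine lintegral_congr_ae (hr.mono fun x hx => ?_)
  obtain ⟨h0, hS⟩ := hx
  have hS' : -x ∈ Sph (n + 1) := (e2_neg x).trans hS
  simp only [cons_one_inv_smul_tail h0]
  rw [mul_left_comm, mul_add, ← posHom_homExt f _ (abs_nonneg _),
    ← posHom_homExt f _ (abs_nonneg _), smul_neg, smul_smul]
  congr 1
  rcases lt_or_gt_of_ne h0 with h | h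
  · rw [abs_of_neg h, neg_mul, mul_inv_cancel₀ h0, neg_smul, one_smul, neg_neg,
      homExt_of_mem_Sph f hS, homExt_of_mem_Sph f hS', add_comm]
  · rw [abs_of_pos h, mul_inv_cancel₀ h0, one_smul, homExt_of_mem_Sph f hS,
      homExt_of_mem_Sph f hS']

lemma isFiniteMeasure_unliftPos {r : Measure (Fin (n + 1) → ℝ)} [IsFiniteMeasure r]
    (hr : ∀ᵐ x ∂r, x ∈ Sph (n + 1)) : IsFiniteMeasure (unliftPos r) := by
  refine ⟨?_⟩
  rw [← lintegral_one, lintegral_unliftPos _ measurable_const]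
  calc _ ≤ ∫⁻ _, 1 ∂r := lintegral_mono_ae (hr.mono fun x hx => by
        have h1 : e2 x = 1 := hx
        simpa [h1] using abs_apply_le_e2 x 0)
    _ < ⊤ := by simp

lemma lintegral_e2_unliftPos_lt_top {r : Measure (Fin (n + 1) → ℝ)} [IsFiniteMeasure r]
    (hr : ∀ᵐ x ∂r, x 0 ≠ 0 ∧ x ∈ Sph (n + 1)) :
    ∫⁻ x, ENNReal.ofReal (e2 x) ∂unliftPos r < ⊤ := by
  rw [lintegral_unliftPos _ measurable_e2.ennreal_ofReal]
  calc _ ≤ ∫⁻ _, 1 ∂r := lintegral_mono_ae (hr.mono fun x hx => by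
        have h1 : e2 x = 1 := hx.2
        rw [← ENNReal.ofReal_mul (abs_nonneg _), e2_smul, ← mul_assoc, ← abs_mul,
          mul_inv_cancel₀ hx.1, abs_one, one_mul]
        simpa [h1] using e2_tail_le x)
    _ < ⊤ := by simp

lemma lintegral_e2_mconvPos_lt_top {p q : Measure (Fin n → ℝ)} [SFinite q]
    (hp : ∫⁻ x, ENNReal.ofReal (e2 x) ∂p < ⊤) (hq : ∫⁻ x, ENNReal.ofReal (e2 x) ∂q < ⊤) :
    ∫⁻ x, ENNReal.ofReal (e2 x) ∂mconvPos p q < ⊤ := by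
  rw [lintegral_mconvPos _ _ measurable_e2.ennreal_ofReal]
  calc _ ≤ ∫⁻ x, ∫⁻ y, ENNReal.ofReal (e2 x) * ENNReal.ofReal (e2 y) ∂q ∂p :=
        lintegral_mono fun x => lintegral_mono fun y => by
          rw [← ENNReal.ofReal_mul (e2_nonneg x)]
          exact ENNReal.ofReal_le_ofReal (e2_mul_le x y)
    _ = (∫⁻ x, ENNReal.ofReal (e2 x) ∂p) * ∫⁻ y, ENNReal.ofReal (e2 y) ∂q := by
        simp_rw [lintegral_const_mul _ measurable_e2.ennreal_ofReal]
        rw [lintegral_mul_const _ measurable_e2.ennreal_ofReal]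
    _ < ⊤ := ENNReal.mul_lt_top hp hq

lemma liftPos_map_flipE (F : Finset (Fin n)) (p : Measure (Fin n → ℝ)) :
    liftPos (p.map (flipE F)) = (liftPos p).map (flipE (F.image Fin.succ)) := by
  refine Measure.ext_of_lintegral _ fun f hf => ?_
  have hm := measurable_homExt hf
  rw [lintegral_liftPos _ hf, lintegral_map (measurable_half_add_neg hm) (measurable_flipE F),
    lintegral_map hf (measurable_flipE _), lintegral_liftPos _ (hf.fun_comp (measurable_flipE _))]
  have h (z : Fin (n + 1) → ℝ) : homExt (fun a => f (flipE (F.image Fin.succ) a)) z =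
      homExt f (flipE (F.image Fin.succ) z) := by
    simp only [homExt, e2_flipE, flipE_smul]
  simp only [h, flipE_neg, flipE_image_succ_cons]

lemma liftPos_map_neg (p : Measure (Fin n → ℝ)) :
    (liftPos p).map (fun x => -x) = liftPos p := by
  refine Measure.ext_of_lintegral _ fun f hf => ?_
  rw [lintegral_map hf measurable_neg, lintegral_liftPos _ hf,
    lintegral_liftPos _ (hf.fun_comp measurable_neg)]
  have h (z : Fin (n + 1) → ℝ) : homExt (fun a => f (-a)) z = homExt f (-z) := by
    simp only [homExt, e2_neg, smul_neg]
  simp only [h, neg_neg, add_comm]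

lemma unliftPos_map_flipE (F : Finset (Fin n)) (r : Measure (Fin (n + 1) → ℝ)) :
    unliftPos (r.map (flipE (F.image Fin.succ))) = (unliftPos r).map (flipE F) := by
  refine Measure.ext_of_lintegral _ fun f hf => ?_
  rw [lintegral_unliftPos _ hf, lintegral_map (measurable_abs_zero.fun_mul
      (hf.fun_comp measurable_inv_smul_tail)) (measurable_flipE _),
    lintegral_map hf (measurable_flipE _), lintegral_unliftPos _ (hf.fun_comp (measurable_flipE _))]
  simp only [flipE_image_succ_zero, tail_flipE_image_succ, flipE_smul]

end PositiveMeasures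

section SignedMeasures

variable {n : ℕ}

lemma integrableSM_iff {μ : SM n} : IntegrableSM μ ↔
    ∫⁻ x, ENNReal.ofReal (e2 x) ∂μ.toJordanDecomposition.posPart < ⊤ ∧
      ∫⁻ x, ENNReal.ofReal (e2 x) ∂μ.toJordanDecomposition.negPart < ⊤ := by
  rw [IntegrableSM, SignedMeasure.totalVariation, lintegral_add_measure, ENNReal.add_lt_top]

lemma concOn_iff {μ : SM n} {S : Set (Fin n → ℝ)} : ConcOn μ S ↔
    (∀ᵐ x ∂μ.toJordanDecomposition.posPart, x ∈ S) ∧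
      ∀ᵐ x ∂μ.toJordanDecomposition.negPart, x ∈ S := by
  rw [ConcOn, SignedMeasure.totalVariation, Measure.add_apply, add_eq_zero]
  rfl

lemma DiffOf.integrableSM {μ : SM n} {p q : Measure (Fin n → ℝ)} (h : DiffOf μ p q)
    (hp : ∫⁻ x, ENNReal.ofReal (e2 x) ∂p < ⊤) (hq : ∫⁻ x, ENNReal.ofReal (e2 x) ∂q < ⊤) :
    IntegrableSM μ :=
  integrableSM_iff.2 ⟨(lintegral_mono' h.posPart_le le_rfl).trans_lt hp,
    (lintegral_mono' h.negPart_le le_rfl).trans_lt hq⟩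

lemma DiffOf.concOn {μ : SM n} {p q : Measure (Fin n → ℝ)} (h : DiffOf μ p q)
    {S : Set (Fin n → ℝ)} (hp : ∀ᵐ x ∂p, x ∈ S) (hq : ∀ᵐ x ∂q, x ∈ S) : ConcOn μ S :=
  concOn_iff.2 ⟨ae_mono h.posPart_le hp, ae_mono h.negPart_le hq⟩

lemma isFiniteMeasure_radPos {p : Measure (Fin n → ℝ)}
    (hp : ∫⁻ x, ENNReal.ofReal (e2 x) ∂p < ⊤) : IsFiniteMeasure (radPos p) :=
  ⟨by rwa [radPos_univ]⟩

lemma DiffOf.radial {μ : SM n} {p q : Measure (Fin n → ℝ)} (h : DiffOf μ p q)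
    (hp : ∫⁻ x, ENNReal.ofReal (e2 x) ∂p < ⊤) (hq : ∫⁻ x, ENNReal.ofReal (e2 x) ∂q < ⊤) :
    DiffOf (PS μ) (radPos p) (radPos q) := by
  obtain ⟨hp', hq'⟩ := integrableSM_iff.1 (h.integrableSM hp hq)
  exact (DiffOf.jordan μ).congr_additive radPos radPos_add h
    (DiffOf.of_toSigned (isFiniteMeasure_radPos hp') (isFiniteMeasure_radPos hq'))
    (isFiniteMeasure_radPos hp) (isFiniteMeasure_radPos hq)

lemma mconvPos_balance_left {p q p' q' r s : Measure (Fin n → ℝ)} [IsFiniteMeasure p]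
    [IsFiniteMeasure q] [IsFiniteMeasure p'] [IsFiniteMeasure q'] [IsFiniteMeasure r]
    [IsFiniteMeasure s] (h : p + q' = p' + q) :
    (mconvPos p r + mconvPos q s) + (mconvPos p' s + mconvPos q' r) =
      (mconvPos p' r + mconvPos q' s) + (mconvPos p s + mconvPos q r) := by
  calc _ = mconvPos (p + q') r + mconvPos (p' + q) s := by
        rw [mconvPos_add_left, mconvPos_add_left]; abel
    _ = mconvPos (p' + q) r + mconvPos (p + q') s := by rw [h]
    _ = _ := by rw [mconvPos_add_left, mconvPos_add_left]; abel

lemma mconvPos_balance_right {p q r s r' s' : Measure (Fin n → ℝ)} [IsFiniteMeasure p]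
    [IsFiniteMeasure q] [IsFiniteMeasure r] [IsFiniteMeasure s] [IsFiniteMeasure r']
    [IsFiniteMeasure s'] (h : r + s' = r' + s) :
    (mconvPos p r + mconvPos q s) + (mconvPos p s' + mconvPos q r') =
      (mconvPos p r' + mconvPos q s') + (mconvPos p s + mconvPos q r) := by
  calc _ = mconvPos p (r + s') + mconvPos q (r' + s) := by
        rw [mconvPos_add_right, mconvPos_add_right]; abel
    _ = mconvPos p (r' + s) + mconvPos q (r + s') := by rw [h]
    _ = _ := by rw [mconvPos_add_right, mconvPos_add_right]; abel

lemma DiffOf.mconv {μ ν : SM n} {p q r s : Measure (Fin n → ℝ)} (h : DiffOf μ p q)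
    (h' : DiffOf ν r s) :
    DiffOf (mconv μ ν) (mconvPos p r + mconvPos q s) (mconvPos p s + mconvPos q r) := by
  have hb := (DiffOf.jordan μ).balance h
  have hb' := (DiffOf.jordan ν).balance h'
  obtain ⟨_, _, -⟩ := h
  obtain ⟨_, _, -⟩ := h'
  exact ((DiffOf.of_toSigned inferInstance inferInstance).congr inferInstance inferInstance
    (mconvPos_balance_left hb)).congr inferInstance inferInstance (mconvPos_balance_right hb')

lemma DiffOf.symLift {κ : SM n} {p q : Measure (Fin n → ℝ)} (h : DiffOf κ p q) :
    DiffOf (Msym (lift0 κ)) (symLiftPos p) (symLiftPos q) :=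
  have h0 := h.map measurable_cons_one
  (h0.add (h0.map measurable_neg)).half

lemma DiffOf.lift {κ : SM n} {p q : Measure (Fin n → ℝ)} (h : DiffOf κ p q)
    (hp : ∫⁻ x, ENNReal.ofReal (e2 x) ∂p < ⊤) (hq : ∫⁻ x, ENNReal.ofReal (e2 x) ∂q < ⊤) :
    DiffOf (Lift κ) (liftPos p) (liftPos q) :=
  have := h.1
  have := h.2.1
  h.symLift.radial (lintegral_e2_symLiftPos_lt_top hp) (lintegral_e2_symLiftPos_lt_top hq)

lemma lintegral_e2_add_lt_top {p q : Measure (Fin n → ℝ)}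
    (hp : ∫⁻ x, ENNReal.ofReal (e2 x) ∂p < ⊤) (hq : ∫⁻ x, ENNReal.ofReal (e2 x) ∂q < ⊤) :
    ∫⁻ x, ENNReal.ofReal (e2 x) ∂(p + q) < ⊤ := by
  rw [lintegral_add_measure]
  exact ENNReal.add_lt_top.2 ⟨hp, hq⟩

lemma integrableSM_mconv {μ ν : SM n} (hμ : IntegrableSM μ) (hν : IntegrableSM ν) :
    IntegrableSM (mconv μ ν) := by
  obtain ⟨hp, hq⟩ := integrableSM_iff.1 hμ
  obtain ⟨hr, hs⟩ := integrableSM_iff.1 hν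
  exact ((DiffOf.jordan μ).mconv (DiffOf.jordan ν)).integrableSM
    (lintegral_e2_add_lt_top (lintegral_e2_mconvPos_lt_top hp hr)
      (lintegral_e2_mconvPos_lt_top hq hs))
    (lintegral_e2_add_lt_top (lintegral_e2_mconvPos_lt_top hp hs)
      (lintegral_e2_mconvPos_lt_top hq hr))

/-- The lifting is multiplicative. -/
lemma mconvS_Lift {μ ν : SM n} (hμ : IntegrableSM μ) (hν : IntegrableSM ν) :
    mconvS (Lift μ) (Lift ν) = Lift (mconv μ ν) := by
  obtain ⟨hp, hq⟩ := integrableSM_iff.1 hμ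
  obtain ⟨hr, hs⟩ := integrableSM_iff.1 hν
  have h := DiffOf.jordan μ
  have h' := DiffOf.jordan ν
  have hL := h.lift hp hq
  have hL' := h'.lift hr hs
  have hm := h.mconv h'
  generalize μ.toJordanDecomposition.posPart = p at *
  generalize μ.toJordanDecomposition.negPart = q at *
  generalize ν.toJordanDecomposition.posPart = r at *
  generalize ν.toJordanDecomposition.negPart = s at *
  obtain ⟨_, _, -⟩ := h
  obtain ⟨_, _, -⟩ := h'
  have hmL := hL.mconv hL'
  obtain ⟨_, _, -⟩ := hL
  obtain ⟨_, _, -⟩ := hL'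
  have key (a b : Measure (Fin n → ℝ)) [IsFiniteMeasure a] [IsFiniteMeasure b]
      [IsFiniteMeasure (liftPos b)] (ha : ∫⁻ x, ENNReal.ofReal (e2 x) ∂a < ⊤)
      (hb : ∫⁻ x, ENNReal.ofReal (e2 x) ∂b < ⊤) :
      ∫⁻ x, ENNReal.ofReal (e2 x) ∂mconvPos (liftPos a) (liftPos b) < ⊤ := by
    rw [← radPos_univ, radPos_mconvPos_liftPos, liftPos, radPos_univ]
    exact lintegral_e2_symLiftPos_lt_top (lintegral_e2_mconvPos_lt_top ha hb)
  have h1 := hmL.radial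
    (lintegral_e2_add_lt_top (key p r hp hr) (key q s hq hs))
    (lintegral_e2_add_lt_top (key p s hp hs) (key q r hq hr))
  have h2 := hm.lift
    (lintegral_e2_add_lt_top (lintegral_e2_mconvPos_lt_top hp hr)
      (lintegral_e2_mconvPos_lt_top hq hs))
    (lintegral_e2_add_lt_top (lintegral_e2_mconvPos_lt_top hp hs)
      (lintegral_e2_mconvPos_lt_top hq hr))
  simp only [radPos_add, radPos_mconvPos_liftPos] at h1
  simp only [liftPos_add] at h2
  exact h1.unique h2

lemma diffOf_zero : DiffOf (0 : SM n) 0 0 :=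
  ⟨inferInstance, inferInstance, fun A _ => by simp⟩

lemma Lift_zero : Lift (0 : SM n) = 0 :=
  (diffOf_zero.lift (by simp) (by simp)).eq_zero_iff.2 rfl

/-- The lifting is injective on integrable measures. -/
lemma Lift_eq_zero_iff {κ : SM n} (hκ : IntegrableSM κ) : Lift κ = 0 ↔ κ = 0 := by
  refine ⟨fun h => ?_, fun h => h ▸ Lift_zero⟩
  obtain ⟨hp, hq⟩ := integrableSM_iff.1 hκ
  have hl := ((DiffOf.jordan κ).lift hp hq).eq_zero_iff.1 h
  rw [(DiffOf.jordan κ).eq_zero_iff, ← unliftPos_liftPos κ.toJordanDecomposition.posPart, hl,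
    unliftPos_liftPos]

lemma measurableSet_setA (E : Finset (Fin n)) : MeasurableSet (setA E) := by
  have : setA E = ⋂ i, {x : Fin n → ℝ | x i ≠ 0 ↔ i ∈ E} := by
    ext x
    simp [setA]
  rw [this]
  refine MeasurableSet.iInter fun i => ?_
  have h0 : MeasurableSet {x : Fin n → ℝ | x i ≠ 0} :=
    (measurableSet_singleton (0 : ℝ)).compl.preimage (measurable_pi_apply i)
  exact h0.iff (MeasurableSet.const _)

lemma measurableSet_Sph : MeasurableSet (Sph n) :=
  measurable_e2 (measurableSet_singleton (1 : ℝ))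

lemma cons_one_mem_setA {E : Finset (Fin n)} {x : Fin n → ℝ} (hx : x ∈ setA E) :
    (Fin.cons 1 x : Fin (n + 1) → ℝ) ∈ setA (insert 0 (E.image Fin.succ)) := by
  intro i
  refine Fin.cases ?_ (fun j => ?_) i
  · simp
  · simpa using hx j

lemma smul_mem_setA {E : Finset (Fin n)} {x : Fin n → ℝ} {c : ℝ} (hc : c ≠ 0)
    (hx : x ∈ setA E) : c • x ∈ setA E := by
  intro i
  rw [← hx i]
  simp [hc]

lemma tail_mem_setA {E : Finset (Fin n)} {x : Fin (n + 1) → ℝ}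
    (hx : x ∈ setA (insert 0 (E.image Fin.succ))) : Fin.tail x ∈ setA E := by
  intro i
  rw [Fin.tail, hx i.succ]
  simp

lemma zero_apply_ne_zero {E : Finset (Fin n)} {x : Fin (n + 1) → ℝ}
    (hx : x ∈ setA (insert 0 (E.image Fin.succ))) : x 0 ≠ 0 :=
  (hx 0).2 (by simp)

lemma ae_liftPos {𝓔 : Set (Finset (Fin n))} {p : Measure (Fin n → ℝ)}
    (hp : ∀ᵐ x ∂p, x ∈ ⋃ E ∈ 𝓔, setA E) :
    ∀ᵐ x ∂liftPos p, x ∈ ⋃ E ∈ 𝓔, (setA (insert 0 (E.image Fin.succ)) ∩ Sph (n + 1)) := by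
  set S : Set (Fin (n + 1) → ℝ) :=
    ⋃ E ∈ 𝓔, (setA (insert 0 (E.image Fin.succ)) ∩ Sph (n + 1))
  have hSm : MeasurableSet S := MeasurableSet.biUnion 𝓔.to_countable fun E _ =>
    (measurableSet_setA _).inter measurableSet_Sph
  have hmem {x : Fin n → ℝ} (hx : x ∈ ⋃ E ∈ 𝓔, setA E) {c : ℝ} (hc : c = 1 ∨ c = -1) :
      (e2 (c • Fin.cons 1 x : Fin (n + 1) → ℝ))⁻¹ • (c • Fin.cons 1 x : Fin (n + 1) → ℝ) ∈ S := by
    simp only [Set.mem_iUnion] at hx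
    obtain ⟨E, hE, hx⟩ := hx
    have hpos : 0 < e2 (c • Fin.cons 1 x : Fin (n + 1) → ℝ) := by
      rw [e2_smul]
      rcases hc with rfl | rfl <;> simpa using e2_cons_one_pos x
    have hc0 : c ≠ 0 := by rcases hc with rfl | rfl <;> norm_num
    refine Set.mem_biUnion hE
      ⟨smul_mem_setA (inv_ne_zero hpos.ne') (smul_mem_setA hc0 (cons_one_mem_setA hx)), ?_⟩
    change e2 _ = 1
    rw [e2_smul, abs_of_pos (inv_pos.2 hpos), inv_mul_cancel₀ hpos.ne']
  rw [ae_iff]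
  change liftPos p Sᶜ = 0
  rw [← lintegral_indicator_one hSm.compl,
    lintegral_liftPos _ (measurable_one.indicator hSm.compl)]
  rw [← lintegral_zero (μ := p)]
  refine lintegral_congr_ae (hp.mono fun x hx => ?_)
  have h1 := hmem hx (Or.inl rfl)
  have h2 := hmem hx (Or.inr rfl)
  rw [one_smul] at h1
  rw [neg_one_smul, smul_neg] at h2
  simp [homExt, Set.indicator, h1, h2]

lemma ae_unliftPos {𝓔 : Set (Finset (Fin n))} {r : Measure (Fin (n + 1) → ℝ)}
    (hr : ∀ᵐ x ∂r, x ∈ ⋃ E ∈ 𝓔, (setA (insert 0 (E.image Fin.succ)) ∩ Sph (n + 1))) :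
    ∀ᵐ x ∂unliftPos r, x ∈ ⋃ E ∈ 𝓔, setA E := by
  have hm : MeasurableSet (⋃ E ∈ 𝓔, setA E) :=
    MeasurableSet.biUnion 𝓔.to_countable fun E _ => measurableSet_setA E
  refine (ae_map_iff measurable_inv_smul_tail.aemeasurable hm).2 ?_
  refine (withDensity_absolutelyContinuous r _).ae_le (hr.mono fun x hx => ?_)
  simp only [Set.mem_iUnion] at hx
  obtain ⟨E, hE, hx, -⟩ := hx
  exact Set.mem_biUnion hE (smul_mem_setA (inv_ne_zero (zero_apply_ne_zero hx)) (tail_mem_setA hx))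

/-- Parity is transported by additive maps of measures which intertwine the reflections. -/
lemma DiffOf.evenUnder {m : ℕ} {μ : SM n} {ν : SM m} {E : Finset (Fin n)} {F : Finset (Fin m)}
    {p q : Measure (Fin n → ℝ)} (Φ : Measure (Fin n → ℝ) → Measure (Fin m → ℝ))
    (hΦ : ∀ r s, Φ (r + s) = Φ r + Φ s)
    (hF : ∀ r, Φ (r.map (flipE E)) = (Φ r).map (flipE F))
    (hμ : DiffOf μ p q) (hν : DiffOf ν (Φ p) (Φ q)) (he : EvenUnder μ E) : EvenUnder ν F := by
  have h := hμ.map (measurable_flipE E)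
  have h' := hν.map (measurable_flipE F)
  rw [← Tmap, he] at h
  refine h'.unique ?_
  rw [← hF, ← hF]
  rw [← hF, ← hF] at h'
  exact hμ.congr_additive Φ hΦ h hν h'.1 h'.2.1

lemma DiffOf.oddUnder {m : ℕ} {μ : SM n} {ν : SM m} {E : Finset (Fin n)} {F : Finset (Fin m)}
    {p q : Measure (Fin n → ℝ)} (Φ : Measure (Fin n → ℝ) → Measure (Fin m → ℝ))
    (hΦ : ∀ r s, Φ (r + s) = Φ r + Φ s)
    (hF : ∀ r, Φ (r.map (flipE E)) = (Φ r).map (flipE F))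
    (hμ : DiffOf μ p q) (hν : DiffOf ν (Φ p) (Φ q)) (ho : OddUnder μ E) : OddUnder ν F := by
  have h := hμ.map (measurable_flipE E)
  have h' := hν.map (measurable_flipE F)
  rw [← Tmap, ho] at h
  refine h'.unique ?_
  rw [← hF, ← hF]
  rw [← hF, ← hF] at h'
  exact hμ.neg.congr_additive Φ hΦ h hν.neg h'.1 h'.2.1

/-- The spherical class corresponding to `MclassInt` under the lifting. -/
def MclassSph (𝓔 Fe Fo : Set (Finset (Fin n))) : Set (SM (n + 1)) :=
  {ρ : SM (n + 1) |
    ConcOn ρ (⋃ E ∈ 𝓔, (setA (insert 0 (E.image Fin.succ)) ∩ Sph (n + 1))) ∧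
    (∀ F ∈ ((fun F : Finset (Fin n) => F.image Fin.succ) '' Fe) ∪
        {(Finset.univ : Finset (Fin (n + 1)))}, EvenUnder ρ F) ∧
    (∀ F ∈ (fun F : Finset (Fin n) => F.image Fin.succ) '' Fo, OddUnder ρ F)}

lemma Lift_mem_MclassSph {𝓔 Fe Fo : Set (Finset (Fin n))} {ν : SM n}
    (hν : ν ∈ MclassInt (⋃ E ∈ 𝓔, setA E) Fe Fo) : Lift ν ∈ MclassSph 𝓔 Fe Fo := by
  obtain ⟨hint, hc, he, ho⟩ := hν
  obtain ⟨hp, hq⟩ := integrableSM_iff.1 hint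
  obtain ⟨hcp, hcq⟩ := concOn_iff.1 hc
  have h := DiffOf.jordan ν
  have hL := h.lift hp hq
  refine ⟨hL.concOn (ae_liftPos hcp) (ae_liftPos hcq), ?_, ?_⟩
  · rintro _ (⟨F, hF, rfl⟩ | rfl)
    · exact h.evenUnder liftPos liftPos_add (liftPos_map_flipE F) hL (he F hF)
    · have h' := hL.map (measurable_flipE Finset.univ)
      rw [flipE_univ, liftPos_map_neg, liftPos_map_neg, ← flipE_univ] at h'
      exact h'.unique hL
  · rintro _ ⟨F, hF, rfl⟩
    exact h.oddUnder liftPos liftPos_add (liftPos_map_flipE F) hL (ho F hF)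

lemma exists_Lift_eq {𝓔 Fe Fo : Set (Finset (Fin n))} {ρ : SM (n + 1)}
    (hρ : ρ ∈ MclassSph 𝓔 Fe Fo) :
    ∃ ν ∈ MclassInt (⋃ E ∈ 𝓔, setA E) Fe Fo, Lift ν = ρ := by
  obtain ⟨hc, he, ho⟩ := hρ
  obtain ⟨hcr, hcs⟩ := concOn_iff.1 hc
  have h := DiffOf.jordan ρ
  generalize ρ.toJordanDecomposition.posPart = r at *
  generalize ρ.toJordanDecomposition.negPart = s at *
  obtain ⟨_, _, -⟩ := id h
  have hS {x : Fin (n + 1) → ℝ}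
      (hx : x ∈ ⋃ E ∈ 𝓔, (setA (insert 0 (E.image Fin.succ)) ∩ Sph (n + 1))) :
      x 0 ≠ 0 ∧ x ∈ Sph (n + 1) := by
    simp only [Set.mem_iUnion] at hx
    obtain ⟨E, -, hx, hxS⟩ := hx
    exact ⟨zero_apply_ne_zero hx, hxS⟩
  have hr := hcr.mono fun x hx => hS hx
  have hs := hcs.mono fun x hx => hS hx
  have hν : DiffOf (toSigned (unliftPos r) - toSigned (unliftPos s)) (unliftPos r)
      (unliftPos s) :=
    DiffOf.of_toSigned (isFiniteMeasure_unliftPos (hr.mono fun _ hx => hx.2))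
      (isFiniteMeasure_unliftPos (hs.mono fun _ hx => hx.2))
  have hir := lintegral_e2_unliftPos_lt_top hr
  have his := lintegral_e2_unliftPos_lt_top hs
  refine ⟨_, ⟨hν.integrableSM hir his, hν.concOn (ae_unliftPos hcr) (ae_unliftPos hcs),
    fun F hF => ?_, fun F hF => ?_⟩, ?_⟩
  · exact h.evenUnder unliftPos unliftPos_add (unliftPos_map_flipE F) hν
      (he _ (Or.inl ⟨F, hF, rfl⟩))
  · exact h.oddUnder unliftPos unliftPos_add (unliftPos_map_flipE F) hν (ho _ ⟨F, hF, rfl⟩)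
  · have hL := hν.lift hir his
    rw [liftPos_unliftPos hr, liftPos_unliftPos hs] at hL
    have h' := (h.add (h.map measurable_neg)).half
    have hev : Tmap Finset.univ ρ = ρ := he _ (Or.inr rfl)
    rw [Tmap, flipE_univ] at hev
    rw [hL.unique h', hev, ← two_smul ℝ ρ, smul_smul]
    norm_num

end SignedMeasures

/-- Theorem: `μ` is universal on `ℳ^int(𝓔; Fe, Fo)` iff `L(μ)` is spherically universal
on `ℳ^sph(𝓔_L; Fe⁰, Fo)`.  Coordinates of `ℝ^{n+1}` are indexed by `Fin (n+1)`, with the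
`0`-th coordinate adjoined by the lifting; a subset `F ⊆ [n]` becomes `F.image Fin.succ`,
`E_L = {0} ∪ E`, and `[n]_L` is the full index set. -/
theorem stmt6 {n : ℕ} (hn : 1 ≤ n) (𝓔 Fe Fo : Set (Finset (Fin n))) (μ : SM n)
    (hint : IntegrableSM μ) :
    Universal μ (MclassInt (⋃ E ∈ 𝓔, setA E) Fe Fo) ↔
      SphUniversal (Lift μ)
        {ρ : SM (n + 1) |
          ConcOn ρ (⋃ E ∈ 𝓔, (setA (insert 0 (E.image Fin.succ)) ∩ Sph (n + 1))) ∧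
          (∀ F ∈ ((fun F : Finset (Fin n) => F.image Fin.succ) '' Fe) ∪
              {(Finset.univ : Finset (Fin (n + 1)))}, EvenUnder ρ F) ∧
          (∀ F ∈ (fun F : Finset (Fin n) => F.image Fin.succ) '' Fo, OddUnder ρ F)} := by
  change _ ↔ SphUniversal (Lift μ) (MclassSph 𝓔 Fe Fo)
  constructor
  · intro h ρ hρ h0
    obtain ⟨ν, hν, rfl⟩ := exists_Lift_eq hρ
    rw [mconvS_Lift hint hν.1, Lift_eq_zero_iff (integrableSM_mconv hint hν.1)] at h0
    rw [h ν hν h0, Lift_zero]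
  · intro h ν hν h0
    rw [← Lift_eq_zero_iff hν.1]
    refine h _ (Lift_mem_MclassSph hν) ?_
    rw [mconvS_Lift hint hν.1, h0, Lift_zero]

end
end

section
/- Let μ₁ and μ₂ be two non-negative finite Borel measures on ℝⁿ. If there is a non-empty open set U ⊆ ℝⁿ such that for all s ∈ U the integrals ∫_{ℝⁿ} exp(⟨x, s⟩) μ₁(dx) and ∫_{ℝⁿ} exp(⟨x, s⟩) μ₂(dx) are finite and equal, then μ₁ = μ₂. -/
open MeasureTheory
open scoped ENNReal symmDiff Classical

noncomputable section

open Filter Topology ProbabilityTheory in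
/-- If the moment-generating functions of two random variables agree near a point of the interior
of both domains, then their complex moment-generating functions agree on the common strip. -/
lemma eqOn_complexMGF_of_mgf_eventuallyEq {Ω Ω' : Type*} {mΩ : MeasurableSpace Ω}
    {mΩ' : MeasurableSpace Ω'} {μ : Measure Ω} {μ' : Measure Ω'} {X : Ω → ℝ} {Y : Ω' → ℝ} {t : ℝ}
    (ht : t ∈ interior (integrableExpSet X μ)) (ht' : t ∈ interior (integrableExpSet Y μ'))
    (hXY : mgf X μ =ᶠ[𝓝 t] mgf Y μ') :
    Set.EqOn (complexMGF X μ) (complexMGF Y μ')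
      {z | z.re ∈ interior (integrableExpSet X μ) ∩ interior (integrableExpSet Y μ')} := by
  have hX : AnalyticOnNhd ℂ (complexMGF X μ)
      {z | z.re ∈ interior (integrableExpSet X μ) ∩ interior (integrableExpSet Y μ')} :=
    analyticOnNhd_complexMGF.mono fun z hz ↦ hz.1
  have hY : AnalyticOnNhd ℂ (complexMGF Y μ')
      {z | z.re ∈ interior (integrableExpSet X μ) ∩ interior (integrableExpSet Y μ')} :=
    analyticOnNhd_complexMGF.mono fun z hz ↦ hz.2
  refine AnalyticOnNhd.eqOn_of_preconnected_of_frequently_eq hX hY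
    ((convex_integrableExpSet.interior.inter convex_integrableExpSet.interior).linear_preimage
      Complex.reLm).isPreconnected (z₀ := (t : ℂ)) ⟨ht, ht'⟩ ?_
  have h_tendsto : Tendsto (fun x : ℝ ↦ (x : ℂ)) (𝓝[≠] t) (𝓝[≠] (t : ℂ)) :=
    Complex.continuous_ofReal.continuousWithinAt.tendsto_nhdsWithin fun x hx ↦ by simpa using hx
  refine h_tendsto.frequently (Eventually.frequently ?_)
  filter_upwards [nhdsWithin_le_nhds hXY] with x hx
  rw [complexMGF_ofReal, complexMGF_ofReal, hx]

open Filter Topology ProbabilityTheory in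
/-- Two finite measures are equal if, along every continuous linear form, their exponential
moments are finite and agree near `0`. -/
lemma MeasureTheory.Measure.ext_of_lintegral_exp_dual {E : Type*} [NormedAddCommGroup E]
    [NormedSpace ℝ E] [MeasurableSpace E] [BorelSpace E] [SecondCountableTopology E]
    [CompleteSpace E] {μ ν : Measure E} [IsFiniteMeasure μ] [IsFiniteMeasure ν]
    (h : ∀ L : StrongDual ℝ E, ∀ᶠ t in 𝓝 (0 : ℝ),
      ∫⁻ x, ENNReal.ofReal (Real.exp (t * L x)) ∂μ = ∫⁻ x, ENNReal.ofReal (Real.exp (t * L x)) ∂ν ∧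
        ∫⁻ x, ENNReal.ofReal (Real.exp (t * L x)) ∂μ ≠ ⊤) :
    μ = ν := by
  refine Measure.ext_of_charFunDual (funext fun L ↦ ?_)
  have h_meas (ρ : Measure E) (t : ℝ) : AEStronglyMeasurable (fun x ↦ Real.exp (t * L x)) ρ :=
    (by fun_prop : Continuous fun x ↦ Real.exp (t * L x)).aestronglyMeasurable
  have h_nonneg (ρ : Measure E) (t : ℝ) : 0 ≤ᵐ[ρ] fun x ↦ Real.exp (t * L x) :=
    ae_of_all _ fun x ↦ (Real.exp_pos _).le
  have hμ : (0 : ℝ) ∈ interior (integrableExpSet L μ) := by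
    rw [mem_interior_iff_mem_nhds]
    filter_upwards [h L] with t ht
    exact (lintegral_ofReal_ne_top_iff_integrable (h_meas μ t) (h_nonneg μ t)).1 ht.2
  have hν : (0 : ℝ) ∈ interior (integrableExpSet L ν) := by
    rw [mem_interior_iff_mem_nhds]
    filter_upwards [h L] with t ht
    exact (lintegral_ofReal_ne_top_iff_integrable (h_meas ν t) (h_nonneg ν t)).1 (ht.1 ▸ ht.2)
  have h_mgf : mgf L μ =ᶠ[𝓝 0] mgf L ν := by
    filter_upwards [h L] with t ht
    rw [mgf, mgf, integral_eq_lintegral_of_nonneg_ae (h_nonneg μ t) (h_meas μ t),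
      integral_eq_lintegral_of_nonneg_ae (h_nonneg ν t) (h_meas ν t), ht.1]
  have h_eq := eqOn_complexMGF_of_mgf_eventuallyEq hμ hν h_mgf
    (x := Complex.I) (by simpa using ⟨hμ, hν⟩)
  simpa only [complexMGF, charFunDual_apply, mul_comm Complex.I] using h_eq

/-- Theorem: uniqueness of the Laplace transform on an open set, for non-negative finite
Borel measures on `ℝⁿ`. -/
theorem stmt9 {n : ℕ} (hn : 1 ≤ n) (μ₁ μ₂ : Measure (Fin n → ℝ))
    [IsFiniteMeasure μ₁] [IsFiniteMeasure μ₂]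
    (U : Set (Fin n → ℝ)) (hU : IsOpen U) (hUne : U.Nonempty)
    (h : ∀ s ∈ U,
      (∫⁻ x, ENNReal.ofReal (Real.exp (∑ i, x i * s i)) ∂μ₁) =
        (∫⁻ x, ENNReal.ofReal (Real.exp (∑ i, x i * s i)) ∂μ₂) ∧
      (∫⁻ x, ENNReal.ofReal (Real.exp (∑ i, x i * s i)) ∂μ₁) ≠ ⊤) :
    μ₁ = μ₂ := by
  obtain ⟨s₀, hs₀⟩ := hUne
  set f : (Fin n → ℝ) → ℝ≥0∞ := fun x ↦ ENNReal.ofReal (Real.exp (∑ i, x i * s₀ i)) with hf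
  have hf_meas : Measurable f := by fun_prop
  have : IsFiniteMeasure (μ₁.withDensity f) := isFiniteMeasure_withDensity (h s₀ hs₀).2
  have : IsFiniteMeasure (μ₂.withDensity f) :=
    isFiniteMeasure_withDensity ((h s₀ hs₀).1 ▸ (h s₀ hs₀).2)
  have h_inv (μ : Measure (Fin n → ℝ)) :
      (μ.withDensity f).withDensity (fun x ↦ (f x)⁻¹) = μ :=
    withDensity_inv_same hf_meas (ae_of_all _ fun x ↦ by simp [hf, Real.exp_pos])
      (ae_of_all _ fun x ↦ ENNReal.ofReal_ne_top)
  suffices h_eq : μ₁.withDensity f = μ₂.withDensity f by rw [← h_inv μ₁, h_eq, h_inv μ₂]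
  refine Measure.ext_of_lintegral_exp_dual fun L ↦ ?_
  set v : Fin n → ℝ := fun i ↦ L (Pi.single i 1)
  have hL (x : Fin n → ℝ) : L x = ∑ i, x i * v i := by
    conv_lhs => rw [pi_eq_sum_univ' x]
    simp [v]
  have h_tilt (μ : Measure (Fin n → ℝ)) (t : ℝ) :
      ∫⁻ x, ENNReal.ofReal (Real.exp (t * L x)) ∂(μ.withDensity f) =
        ∫⁻ x, ENNReal.ofReal (Real.exp (∑ i, x i * (s₀ + t • v) i)) ∂μ := by
    rw [lintegral_withDensity_eq_lintegral_mul _ hf_meas (by fun_prop)]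
    refine lintegral_congr fun x ↦ ?_
    rw [Pi.mul_apply, hf, ← ENNReal.ofReal_mul (Real.exp_pos _).le, ← Real.exp_add, hL,
      Finset.mul_sum, ← Finset.sum_add_distrib]
    congr! 3 with i
    simp only [Pi.add_apply, Pi.smul_apply, smul_eq_mul]
    ring
  have h_cont : ContinuousAt (fun t : ℝ ↦ s₀ + t • v) 0 := by fun_prop
  filter_upwards [h_cont.preimage_mem_nhds (hU.mem_nhds (by simpa using hs₀))] with t ht
  rw [h_tilt, h_tilt]
  exact h _ ht

end
end

section
/- Let μ₁ and μ₂ be two non-negative finite Borel measures on (0,∞)ⁿ. If there is a non-empty open set U ⊆ ℝⁿ such that for all α ∈ U the integrals ∫_{(0,∞)ⁿ} [x]^α μ₁(dx) and ∫_{(0,∞)ⁿ} [x]^α μ₂(dx) are finite and equal, then μ₁ = μ₂. -/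
open MeasureTheory
open scoped ENNReal symmDiff Classical

noncomputable section

/-- If two moment generating functions are finite and agree near `0`, then the complex moment
generating functions agree on the imaginary axis. -/
theorem complexMGF_mul_I_eq_of_mgf_eventuallyEq {Ω Ω' : Type*} {_ : MeasurableSpace Ω}
    {_ : MeasurableSpace Ω'} {X : Ω → ℝ} {Y : Ω' → ℝ} {μ : Measure Ω} {ν : Measure Ω'}
    (hX : 0 ∈ interior (ProbabilityTheory.integrableExpSet X μ))
    (hY : 0 ∈ interior (ProbabilityTheory.integrableExpSet Y ν))
    (h : ∀ᶠ s in nhds (0 : ℝ), ProbabilityTheory.mgf X μ s = ProbabilityTheory.mgf Y ν s)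
    (t : ℝ) :
    ProbabilityTheory.complexMGF X μ (t * Complex.I) =
      ProbabilityTheory.complexMGF Y ν (t * Complex.I) := by
  set A := interior (ProbabilityTheory.integrableExpSet X μ) with hA
  set B := interior (ProbabilityTheory.integrableExpSet Y ν) with hB
  have hX' : AnalyticOnNhd ℂ (ProbabilityTheory.complexMGF X μ) {z | z.re ∈ A ∩ B} :=
    ProbabilityTheory.analyticOnNhd_complexMGF.mono fun z hz => hz.1
  have hY' : AnalyticOnNhd ℂ (ProbabilityTheory.complexMGF Y ν) {z | z.re ∈ A ∩ B} :=
    ProbabilityTheory.analyticOnNhd_complexMGF.mono fun z hz => hz.2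
  have hconv : Convex ℝ (A ∩ B) :=
    ProbabilityTheory.convex_integrableExpSet.interior.inter
      ProbabilityTheory.convex_integrableExpSet.interior
  have hfreq : ∃ᶠ z in nhdsWithin (0 : ℂ) {0}ᶜ,
      ProbabilityTheory.complexMGF X μ z = ProbabilityTheory.complexMGF Y ν z := by
    have h_real : ∃ᶠ s : ℝ in nhdsWithin (0 : ℝ) {0}ᶜ,
        ProbabilityTheory.complexMGF X μ (s : ℂ) =
          ProbabilityTheory.complexMGF Y ν (s : ℂ) := by
      refine (Filter.Eventually.filter_mono nhdsWithin_le_nhds ?_).frequently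
      filter_upwards [h] with s hs
      rw [ProbabilityTheory.complexMGF_ofReal, ProbabilityTheory.complexMGF_ofReal, hs]
    refine Filter.Tendsto.frequently (f := Complex.ofReal) ?_ h_real
    refine tendsto_nhdsWithin_iff.2 ⟨?_, ?_⟩
    · exact (Complex.continuous_ofReal.tendsto' 0 0 Complex.ofReal_zero).mono_left
        nhdsWithin_le_nhds
    · filter_upwards [self_mem_nhdsWithin] with s hs
      simpa using hs
  exact AnalyticOnNhd.eqOn_of_preconnected_of_frequently_eq hX' hY'
    (hconv.linear_preimage Complex.reLm).isPreconnected (z₀ := 0)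
    (by simpa using ⟨hX, hY⟩) hfreq (by simpa using ⟨hX, hY⟩)

/-- Two finite measures whose continuous linear functionals have moment generating functions
that are finite and agree near `0` are equal. -/
theorem ext_of_mgf_dual_eventuallyEq {E : Type*} [NormedAddCommGroup E] [NormedSpace ℝ E]
    [MeasurableSpace E] [BorelSpace E] [SecondCountableTopology E] [CompleteSpace E]
    {μ ν : Measure E} [IsFiniteMeasure μ] [IsFiniteMeasure ν]
    (hμ : ∀ L : StrongDual ℝ E, 0 ∈ interior (ProbabilityTheory.integrableExpSet L μ))
    (hν : ∀ L : StrongDual ℝ E, 0 ∈ interior (ProbabilityTheory.integrableExpSet L ν))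
    (h : ∀ L : StrongDual ℝ E, ∀ᶠ s in nhds (0 : ℝ),
      ProbabilityTheory.mgf L μ s = ProbabilityTheory.mgf L ν s) :
    μ = ν := by
  refine Measure.ext_of_charFunDual (funext fun L => ?_)
  have := complexMGF_mul_I_eq_of_mgf_eventuallyEq (hμ L) (hν L) (h L) 1
  simpa [ProbabilityTheory.complexMGF, charFunDual_apply, mul_comm] using this

/-- The Laplace transform, where finite on a nonempty open set, determines a measure. -/
theorem ext_of_lintegral_exp_eq {ι : Type*} [Fintype ι] {μ ν : Measure (ι → ℝ)}
    {U : Set (ι → ℝ)} (hU : IsOpen U) (hUne : U.Nonempty)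
    (h : ∀ α ∈ U, ∫⁻ y, ENNReal.ofReal (Real.exp (∑ j, α j * y j)) ∂μ =
      ∫⁻ y, ENNReal.ofReal (Real.exp (∑ j, α j * y j)) ∂ν)
    (hfin : ∀ α ∈ U, ∫⁻ y, ENNReal.ofReal (Real.exp (∑ j, α j * y j)) ∂μ ≠ ⊤) :
    μ = ν := by
  obtain ⟨α, hα⟩ := hUne
  set f : (ι → ℝ) → ℝ≥0∞ := fun y => ENNReal.ofReal (Real.exp (∑ j, α j * y j)) with hf
  have hfm : Measurable f := by fun_prop
  have hf0 : ∀ y, f y ≠ 0 := fun y => by simp [hf, Real.exp_pos]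
  have hft : ∀ y, f y ≠ ⊤ := fun y => ENNReal.ofReal_ne_top
  have hfin' : ∀ α ∈ U, ∫⁻ y, ENNReal.ofReal (Real.exp (∑ j, α j * y j)) ∂ν ≠ ⊤ :=
    fun β hβ => h β hβ ▸ hfin β hβ
  have hdir : ∀ L : StrongDual ℝ (ι → ℝ), ∃ β : ι → ℝ, ∀ y, L y = ∑ j, β j * y j := by
    intro L
    refine ⟨fun j => L (Pi.single j 1), fun y => ?_⟩
    have := LinearMap.pi_apply_eq_sum_univ (L : (ι → ℝ) →ₗ[ℝ] ℝ) y
    simp only [ContinuousLinearMap.coe_coe, smul_eq_mul] at this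
    rw [this]
    refine Finset.sum_congr rfl fun j _ => ?_
    rw [mul_comm]
    congr 2
    ext k
    simp [Pi.single_apply, eq_comm]
  have hmem : ∀ β : ι → ℝ, ∀ᶠ s in nhds (0 : ℝ), α + s • β ∈ U := by
    intro β
    have hc : Continuous fun s : ℝ => α + s • β := by fun_prop
    exact hc.continuousAt.eventually_mem (hU.mem_nhds (by simpa using hα))
  have hlin : ∀ (ρ : Measure (ι → ℝ)) (L : StrongDual ℝ (ι → ℝ)) (β : ι → ℝ),
      (∀ y, L y = ∑ j, β j * y j) → ∀ s : ℝ,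
      ∫⁻ y, ENNReal.ofReal (Real.exp (s * L y)) ∂(ρ.withDensity f) =
        ∫⁻ y, ENNReal.ofReal (Real.exp (∑ j, (α + s • β) j * y j)) ∂ρ := by
    intro ρ L β hL s
    rw [lintegral_withDensity_eq_lintegral_mul _ hfm (by fun_prop)]
    refine lintegral_congr fun y => ?_
    simp only [Pi.mul_apply, hf]
    rw [← ENNReal.ofReal_mul (Real.exp_pos _).le, ← Real.exp_add, hL, Finset.mul_sum,
      ← Finset.sum_add_distrib]
    congr 3 with j
    simp only [Pi.add_apply, Pi.smul_apply, smul_eq_mul]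
    ring
  have hint : ∀ ρ : Measure (ι → ℝ),
      (∀ α ∈ U, ∫⁻ y, ENNReal.ofReal (Real.exp (∑ j, α j * y j)) ∂ρ ≠ ⊤) →
      ∀ L : StrongDual ℝ (ι → ℝ),
        0 ∈ interior (ProbabilityTheory.integrableExpSet L (ρ.withDensity f)) := by
    intro ρ hρ L
    obtain ⟨β, hβ⟩ := hdir L
    rw [mem_interior_iff_mem_nhds]
    filter_upwards [hmem β] with s hs
    refine (lintegral_ofReal_ne_top_iff_integrable (by fun_prop)
      (Filter.Eventually.of_forall fun y => (Real.exp_pos _).le)).1 ?_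
    rw [hlin ρ L β hβ s]
    exact hρ _ hs
  have : IsFiniteMeasure (μ.withDensity f) := isFiniteMeasure_withDensity (hfin α hα)
  have : IsFiniteMeasure (ν.withDensity f) := isFiniteMeasure_withDensity (hfin' α hα)
  have key : μ.withDensity f = ν.withDensity f := by
    refine ext_of_mgf_dual_eventuallyEq (hint μ hfin) (hint ν hfin') fun L => ?_
    obtain ⟨β, hβ⟩ := hdir L
    filter_upwards [hmem β] with s hs
    have hmgf : ∀ ρ : Measure (ι → ℝ), ProbabilityTheory.mgf L ρ s =
        (∫⁻ y, ENNReal.ofReal (Real.exp (s * L y)) ∂ρ).toReal := fun ρ =>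
      integral_eq_lintegral_of_nonneg_ae
        (Filter.Eventually.of_forall fun y => (Real.exp_pos _).le) (by fun_prop)
    rw [hmgf, hmgf, hlin μ L β hβ, hlin ν L β hβ, h _ hs]
  rw [← withDensity_inv_same hfm (.of_forall hf0) (.of_forall hft) (μ := μ), key,
    withDensity_inv_same hfm (.of_forall hf0) (.of_forall hft)]

/-- Theorem: uniqueness of the Mellin-type transform `α ↦ ∫ [x]^α dμ` on an open set, for
non-negative finite Borel measures on `(0,∞)ⁿ` (measures on `ℝⁿ` concentrated on the
open positive orthant). -/
theorem stmt10 {n : ℕ} (hn : 1 ≤ n) (μ₁ μ₂ : Measure (Fin n → ℝ))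
    [IsFiniteMeasure μ₁] [IsFiniteMeasure μ₂]
    (hc₁ : μ₁ {x | ∀ i, 0 < x i}ᶜ = 0) (hc₂ : μ₂ {x | ∀ i, 0 < x i}ᶜ = 0)
    (U : Set (Fin n → ℝ)) (hU : IsOpen U) (hUne : U.Nonempty)
    (h : ∀ α ∈ U,
      (∫⁻ x in {x | ∀ i, 0 < x i}, ENNReal.ofReal (∏ j, (x j) ^ (α j)) ∂μ₁) =
        (∫⁻ x in {x | ∀ i, 0 < x i}, ENNReal.ofReal (∏ j, (x j) ^ (α j)) ∂μ₂) ∧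
      (∫⁻ x in {x | ∀ i, 0 < x i}, ENNReal.ofReal (∏ j, (x j) ^ (α j)) ∂μ₁) ≠ ⊤) :
    μ₁ = μ₂ := by
  set S : Set (Fin n → ℝ) := {x | ∀ i, 0 < x i} with hS
  have hSm : MeasurableSet S := by
    rw [hS, Set.ofPred_forall]
    exact MeasurableSet.iInter fun i => measurableSet_lt measurable_const (measurable_pi_apply i)
  let l : (Fin n → ℝ) → (Fin n → ℝ) := fun x j => Real.log (x j)
  let e : (Fin n → ℝ) → (Fin n → ℝ) := fun y j => Real.exp (y j)
  have hl : Measurable l := by fun_prop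
  have he : Measurable e := by fun_prop
  have hmap : ∀ (μ : Measure (Fin n → ℝ)) (α : Fin n → ℝ),
      ∫⁻ y, ENNReal.ofReal (Real.exp (∑ j, α j * y j)) ∂((μ.restrict S).map l) =
        ∫⁻ x in S, ENNReal.ofReal (∏ j, (x j) ^ (α j)) ∂μ := by
    intro μ α
    rw [lintegral_map (by fun_prop) hl]
    refine setLIntegral_congr_fun hSm fun x hx => ?_
    simp only [l, Real.exp_sum]
    congr 1
    refine Finset.prod_congr rfl fun j _ => ?_
    rw [Real.rpow_def_of_pos (hx j), mul_comm]
  have hback : ∀ μ : Measure (Fin n → ℝ), μ Sᶜ = 0 → ((μ.restrict S).map l).map e = μ := by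
    intro μ hμ
    rw [Measure.map_map he hl, Measure.map_congr (g := id), Measure.map_id]
    · exact Measure.restrict_eq_self_of_ae_mem (mem_ae_iff.2 hμ)
    · filter_upwards [ae_restrict_mem hSm] with x hx
      funext j
      exact Real.exp_log (hx j)
  have key : (μ₁.restrict S).map l = (μ₂.restrict S).map l := by
    refine ext_of_lintegral_exp_eq hU hUne (fun α hα => ?_) fun α hα => ?_
    · rw [hmap, hmap]
      exact (h α hα).1
    · rw [hmap]
      exact (h α hα).2
  rw [← hback μ₁ hc₁, key, hback μ₂ hc₂]

end
end
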